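/- arXiv:math/0509019 — 6 statements merged into one kernel-verified Lean document; each statement's English description precedes it below -/
import Mathlib

section
/- For every a > 0, the function φ(·,a) : ℝ³ → ℝ defined by φ(x,a) = (3a)^{1/4}(1 + a|x|²)^{-1/2} satisfies Δφ(x,a) + φ(x,a)⁵ = 0 at every point x ∈ ℝ³. -/
open MeasureTheory

/-- The Laplacian: sum of second partial derivatives in the coordinate directions. -/
noncomputable def lap {d : ℕ} (f : EuclideanSpace ℝ (Fin d) → ℝ)
    (x : EuclideanSpace ℝ (Fin d)) : ℝ :=
  ∑ j, fderiv ℝ (fun y => fderiv ℝ f y (EuclideanSpace.single j 1)) x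
    (EuclideanSpace.single j 1)

/-- The static solutions φ(x,a) = (3a)^{1/4} (1 + a|x|²)^{-1/2} of the quintic NLW. -/
noncomputable def phi (a : ℝ) (x : EuclideanSpace ℝ (Fin 3)) : ℝ :=
  (3 * a) ^ ((1 : ℝ) / 4) * (1 + a * ‖x‖ ^ 2) ^ (-(1 : ℝ) / 2)

lemma hasFDerivAt_one_add_mul_norm_sq_rpow {E : Type*} [NormedAddCommGroup E]
    [InnerProductSpace ℝ E] {a : ℝ} (ha : 0 ≤ a) (p : ℝ) (y : E) :
    HasFDerivAt (fun z : E => (1 + a * ‖z‖ ^ 2) ^ p)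
      ((2 * a * p * (1 + a * ‖y‖ ^ 2) ^ (p - 1)) • innerSL ℝ y) y := by
  have hu : 1 + a * ‖y‖ ^ 2 ≠ 0 := by positivity
  have h := ((((hasStrictFDerivAt_norm_sq y).hasFDerivAt).const_mul a).const_add 1).rpow_const
    (p := p) (Or.inl hu)
  convert h using 1
  ext v
  simp
  ring

lemma lap_const_mul_one_add_mul_norm_sq_rpow {d : ℕ} {a : ℝ} (ha : 0 ≤ a) (c p : ℝ)
    (x : EuclideanSpace ℝ (Fin d)) :
    lap (fun y => c * (1 + a * ‖y‖ ^ 2) ^ p) x =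
      c * (4 * a ^ 2 * p * (p - 1) * (1 + a * ‖x‖ ^ 2) ^ (p - 2) * ‖x‖ ^ 2
        + 2 * a * p * d * (1 + a * ‖x‖ ^ 2) ^ (p - 1)) := by
  have first (j : Fin d) (y : EuclideanSpace ℝ (Fin d)) :
      fderiv ℝ (fun z => c * (1 + a * ‖z‖ ^ 2) ^ p) y (EuclideanSpace.single j 1) =
        c * (2 * a * p) * ((1 + a * ‖y‖ ^ 2) ^ (p - 1) * y j) := by
    rw [((hasFDerivAt_one_add_mul_norm_sq_rpow ha p y).const_mul c).fderiv]
    simp [EuclideanSpace.inner_single_right]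
    ring
  have second (j : Fin d) :
      fderiv ℝ (fun y : EuclideanSpace ℝ (Fin d) =>
          c * (2 * a * p) * ((1 + a * ‖y‖ ^ 2) ^ (p - 1) * y j)) x
          (EuclideanSpace.single j 1) =
        c * (4 * a ^ 2 * p * (p - 1) * (1 + a * ‖x‖ ^ 2) ^ (p - 2)) * x j ^ 2
          + c * (2 * a * p * (1 + a * ‖x‖ ^ 2) ^ (p - 1)) := by
    have hcoord : HasFDerivAt (fun y : EuclideanSpace ℝ (Fin d) => y j)
        (EuclideanSpace.proj j : EuclideanSpace ℝ (Fin d) →L[ℝ] ℝ) x :=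
      (EuclideanSpace.proj j : EuclideanSpace ℝ (Fin d) →L[ℝ] ℝ).hasFDerivAt
    rw [(((hasFDerivAt_one_add_mul_norm_sq_rpow ha (p - 1) x).fun_mul hcoord).const_mul
      (c * (2 * a * p))).fderiv, show p - 1 - 1 = p - 2 by ring]
    simp [EuclideanSpace.inner_single_right]
    ring
  simp only [lap, first, second]
  rw [Finset.sum_add_distrib, ← Finset.mul_sum, ← EuclideanSpace.real_norm_sq_eq]
  simp
  ring

/-- For every a > 0, Δφ(·,a) + φ(·,a)⁵ = 0 at every point of ℝ³. -/
theorem quintic_static_solution (a : ℝ) (ha : 0 < a) (x : EuclideanSpace ℝ (Fin 3)) :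
    lap (phi a) x + (phi a x) ^ 5 = 0 := by
  have hu : 0 < 1 + a * ‖x‖ ^ 2 := by positivity
  have hc : ((3 * a) ^ ((1 : ℝ) / 4)) ^ 4 = 3 * a := by
    rw [← Real.rpow_mul_natCast (by positivity)]
    norm_num
  have hpow : ((1 + a * ‖x‖ ^ 2) ^ (-(1 : ℝ) / 2)) ^ 5
      = (1 + a * ‖x‖ ^ 2) ^ (-(1 : ℝ) / 2 - 2) := by
    rw [← Real.rpow_mul_natCast hu.le]
    norm_num
  have hstep : (1 + a * ‖x‖ ^ 2) ^ (-(1 : ℝ) / 2 - 1)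
      = (1 + a * ‖x‖ ^ 2) ^ (-(1 : ℝ) / 2 - 2) * (1 + a * ‖x‖ ^ 2) := by
    rw [← Real.rpow_add_one hu.ne']
    norm_num
  have hlap := lap_const_mul_one_add_mul_norm_sq_rpow ha.le
    ((3 * a) ^ ((1 : ℝ) / 4)) (-(1 : ℝ) / 2) x
  rw [show phi a = fun y => (3 * a) ^ ((1 : ℝ) / 4) * (1 + a * ‖y‖ ^ 2) ^ (-(1 : ℝ) / 2) from rfl,
    hlap, mul_pow, hpow, pow_succ _ 4, hc, hstep]
  push_cast
  ring
end

section
/- For every a > 0, the functions x ↦ |∇φ(x,a)|² and x ↦ φ(x,a)⁶ are Lebesgue integrable on ℝ³, one has ∫_{ℝ³} |∇φ(x,a)|² dx = ∫_{ℝ³} φ(x,a)⁶ dx, and consequently ∫_{ℝ³} (|∇φ(x,a)|² − 5 φ(x,a)⁶) dx = −4 ∫_{ℝ³} φ(x,a)⁶ dx < 0. -/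
open MeasureTheory

lemma phi_pow_six {a : ℝ} (ha : 0 < a) (x : EuclideanSpace ℝ (Fin 3)) :
    phi a x ^ 6 = √(3 * a) * (3 * a / (1 + a * ‖x‖ ^ 2) ^ 3) := by
  have hb : 0 < 1 + a * ‖x‖ ^ 2 := by positivity
  have hc : 0 < 3 * a := by positivity
  have h1 : ((3 * a) ^ ((1 : ℝ) / 4)) ^ 6 = √(3 * a) * (3 * a) := by
    rw [← Real.rpow_mul_natCast hc.le, Real.sqrt_eq_rpow, ← Real.rpow_add_one hc.ne']
    norm_num
  have h2 : ((1 + a * ‖x‖ ^ 2) ^ (-(1 : ℝ) / 2)) ^ 6 = ((1 + a * ‖x‖ ^ 2) ^ 3)⁻¹ := by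
    rw [← Real.rpow_mul_natCast hb.le, ← Real.rpow_natCast _ 3, ← Real.rpow_neg hb.le]
    norm_num
  rw [phi, mul_pow, h1, h2]
  ring

lemma hasGradientAt_phi {a : ℝ} (ha : 0 < a) (x : EuclideanSpace ℝ (Fin 3)) :
    HasGradientAt (phi a)
      ((-((3 * a) ^ ((1 : ℝ) / 4) * a * (1 + a * ‖x‖ ^ 2) ^ (-(3 : ℝ) / 2))) • x) x := by
  have hb : 0 < 1 + a * ‖x‖ ^ 2 := by positivity
  have h := ((((hasStrictFDerivAt_norm_sq x).hasFDerivAt.const_mul a).const_add 1).rpow_const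
    (p := -(1 : ℝ) / 2) (Or.inl hb.ne')).const_mul ((3 * a) ^ ((1 : ℝ) / 4))
  rw [hasGradientAt_iff_hasFDerivAt]
  refine h.congr_fderiv ?_
  ext y
  have he : (-(1 : ℝ) / 2 - 1) = -(3 : ℝ) / 2 := by norm_num
  simp only [he, map_smul, InnerProductSpace.toDual_apply_apply, innerSL_apply_apply,
    smul_apply, smul_eq_mul, map_neg, neg_smul,
    neg_apply, two_smul, add_apply]
  ring

lemma norm_gradient_phi_sq {a : ℝ} (ha : 0 < a) (x : EuclideanSpace ℝ (Fin 3)) :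
    ‖gradient (phi a) x‖ ^ 2
      = √(3 * a) * (a ^ 2 * ‖x‖ ^ 2 / (1 + a * ‖x‖ ^ 2) ^ 3) := by
  have hb : 0 < 1 + a * ‖x‖ ^ 2 := by positivity
  have hc : 0 < 3 * a := by positivity
  have h1 : ((3 * a) ^ ((1 : ℝ) / 4)) ^ 2 = √(3 * a) := by
    rw [← Real.rpow_mul_natCast hc.le, Real.sqrt_eq_rpow]
    norm_num
  have h2 : ((1 + a * ‖x‖ ^ 2) ^ (-(3 : ℝ) / 2)) ^ 2 = ((1 + a * ‖x‖ ^ 2) ^ 3)⁻¹ := by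
    rw [← Real.rpow_mul_natCast hb.le, ← Real.rpow_natCast _ 3, ← Real.rpow_neg hb.le]
    norm_num
  rw [(hasGradientAt_phi ha x).gradient, norm_smul, mul_pow, Real.norm_eq_abs, sq_abs, neg_sq,
    mul_pow, mul_pow, h1, h2]
  ring

lemma integrable_inv_one_add_mul_sq {a : ℝ} (ha : 0 < a) :
    Integrable (fun r : ℝ => (1 + a * r ^ 2)⁻¹) := by
  have h := integrable_inv_one_add_sq.comp_mul_left' (Real.sqrt_pos.2 ha).ne'
  simpa only [mul_pow, Real.sq_sqrt ha.le] using h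

lemma integrable_pow_four_div {a : ℝ} (ha : 0 < a) :
    Integrable (fun r : ℝ => r ^ 2 * (a ^ 2 * r ^ 2 / (1 + a * r ^ 2) ^ 3)) := by
  have hb (r : ℝ) : 0 < 1 + a * r ^ 2 := by positivity
  refine (integrable_inv_one_add_mul_sq ha).mono' ?_ (.of_forall fun r => ?_)
  · exact Continuous.aestronglyMeasurable
      (by fun_prop (disch := intro r; exact (pow_pos (hb r) 3).ne'))
  · have := hb r
    have h0 : 0 ≤ a * r ^ 2 := by positivity
    rw [Real.norm_of_nonneg (by positivity), ← mul_div_assoc, inv_eq_one_div,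
      div_le_div_iff₀ (by positivity) this]
    nlinarith [mul_nonneg this.le h0, mul_nonneg this.le this.le]

lemma integrable_sq_div {a : ℝ} (ha : 0 < a) :
    Integrable (fun r : ℝ => r ^ 2 * (3 * a / (1 + a * r ^ 2) ^ 3)) := by
  have hb (r : ℝ) : 0 < 1 + a * r ^ 2 := by positivity
  refine ((integrable_inv_one_add_mul_sq ha).const_mul 3).mono' ?_ (.of_forall fun r => ?_)
  · exact Continuous.aestronglyMeasurable
      (by fun_prop (disch := intro r; exact (pow_pos (hb r) 3).ne'))
  · have := hb r
    have h0 : 0 ≤ a * r ^ 2 := by positivity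
    rw [Real.norm_of_nonneg (by positivity), ← mul_div_assoc, ← div_eq_mul_inv,
      div_le_div_iff₀ (by positivity) this]
    nlinarith [mul_nonneg this.le h0, mul_nonneg this.le this.le]

lemma integral_Ioi_radial_eq {a : ℝ} (ha : 0 < a) :
    ∫ r in Set.Ioi (0 : ℝ), r ^ 2 * (a ^ 2 * r ^ 2 / (1 + a * r ^ 2) ^ 3)
      = ∫ r in Set.Ioi (0 : ℝ), r ^ 2 * (3 * a / (1 + a * r ^ 2) ^ 3) := by
  have hb (r : ℝ) : 0 < 1 + a * r ^ 2 := by positivity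
  have h4 := (integrable_pow_four_div ha).integrableOn (s := Set.Ioi (0 : ℝ))
  have h2 := (integrable_sq_div ha).integrableOn (s := Set.Ioi (0 : ℝ))
  rw [← sub_eq_zero, ← integral_sub h4 h2]
  have hderiv (r : ℝ) : HasDerivAt (fun r : ℝ => -a * r ^ 3 / (1 + a * r ^ 2) ^ 2)
      (r ^ 2 * (a ^ 2 * r ^ 2 / (1 + a * r ^ 2) ^ 3)
        - r ^ 2 * (3 * a / (1 + a * r ^ 2) ^ 3)) r := by
    have := (hb r).ne'
    have h := ((hasDerivAt_pow 3 r).const_mul (-a)).fun_div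
      ((((hasDerivAt_pow 2 r).const_mul a).const_add 1).fun_pow 2) (pow_ne_zero 2 this)
    refine h.congr_deriv ?_
    field_simp
    push_cast
    ring
  have hlim : Filter.Tendsto (fun r : ℝ => -a * r ^ 3 / (1 + a * r ^ 2) ^ 2) Filter.atTop
      (nhds 0) := by
    refine squeeze_zero_norm' (a := fun r : ℝ => a⁻¹ * r⁻¹) ?_ ?_
    · filter_upwards [Filter.eventually_gt_atTop 0] with r hr
      have := hb r
      rw [neg_mul, neg_div, norm_neg, Real.norm_of_nonneg (by positivity), ← mul_inv,
        inv_eq_one_div, div_le_div_iff₀ (by positivity) (by positivity)]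
      nlinarith [mul_pos ha (pow_pos hr 2)]
    · simpa using tendsto_inv_atTop_zero.const_mul a⁻¹
  simpa using integral_Ioi_of_hasDerivAt_of_tendsto' (fun r _ => hderiv r) (h4.sub h2) hlim

/-- For every a > 0, |∇φ(·,a)|² and φ(·,a)⁶ are integrable on ℝ³,
∫|∇φ|² = ∫φ⁶, and hence ∫(|∇φ|² − 5φ⁶) = −4∫φ⁶ < 0. -/
theorem quadratic_form_negative (a : ℝ) (ha : 0 < a) :
    Integrable (fun x => ‖gradient (phi a) x‖ ^ 2) volume ∧
    Integrable (fun x => (phi a x) ^ 6) volume ∧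
    (∫ x, ‖gradient (phi a) x‖ ^ 2) = (∫ x, (phi a x) ^ 6) ∧
    (∫ x, (‖gradient (phi a) x‖ ^ 2 - 5 * (phi a x) ^ 6)) = -4 * ∫ x, (phi a x) ^ 6 ∧
    -4 * (∫ x, (phi a x) ^ 6) < 0 := by
  have hgrad : Integrable (fun x => ‖gradient (phi a) x‖ ^ 2) volume := by
    simp only [norm_gradient_phi_sq ha]
    refine Integrable.const_mul ((integrable_fun_norm_addHaar volume
      (f := fun r : ℝ => a ^ 2 * r ^ 2 / (1 + a * r ^ 2) ^ 3)).2 ?_) _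
    simpa using (integrable_pow_four_div ha).integrableOn
  have hsix : Integrable (fun x => (phi a x) ^ 6) volume := by
    simp only [phi_pow_six ha]
    refine Integrable.const_mul ((integrable_fun_norm_addHaar volume
      (f := fun r : ℝ => 3 * a / (1 + a * r ^ 2) ^ 3)).2 ?_) _
    simpa using (integrable_sq_div ha).integrableOn
  have heq : (∫ x, ‖gradient (phi a) x‖ ^ 2) = ∫ x, (phi a x) ^ 6 := by
    simp only [norm_gradient_phi_sq ha, phi_pow_six ha, integral_const_mul]
    rw [integral_fun_norm_addHaar volume (fun r : ℝ => a ^ 2 * r ^ 2 / (1 + a * r ^ 2) ^ 3),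
      integral_fun_norm_addHaar volume (fun r : ℝ => 3 * a / (1 + a * r ^ 2) ^ 3)]
    simp only [finrank_euclideanSpace, Fintype.card_fin, Nat.add_one_sub_one, smul_eq_mul,
      integral_Ioi_radial_eq ha]
  have hphi (x : EuclideanSpace ℝ (Fin 3)) : 0 < phi a x ^ 6 := by
    rw [phi]
    positivity
  have hpos : 0 < ∫ x, (phi a x) ^ 6 := by
    rw [integral_pos_iff_support_of_nonneg (fun x => (hphi x).le) hsix,
      Function.support_eq_univ fun x => (hphi x).ne']
    exact Measure.measure_univ_pos.2 (NeZero.ne _)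
  refine ⟨hgrad, hsix, heq, ?_, by linarith⟩
  rw [integral_sub hgrad (hsix.const_mul 5), integral_const_mul, heq]
  ring
end

section
/- There exists a constant C > 0 such that for all a₁, a₂ ∈ (1/2, 2) and all x ∈ ℝ³ one has |∂_a φ(x,a₁) − (a₂/a₁)^{5/4} ∂_a φ(x,a₂)| ≤ C |a₁ − a₂| (1 + |x|)^{-3}. -/
open MeasureTheory

/-- The function `a ↦ a^{5/4} ∂ₐφ(x,a)`, up to a constant factor, with `s = |x|²`. -/
noncomputable def phiProfile (s a : ℝ) : ℝ :=
  a ^ ((1 : ℝ) / 2) * ((1 - a * s) * (1 + a * s) ^ (-(3 : ℝ) / 2))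

lemma deriv_phi_eq {a : ℝ} (ha : 0 < a) (x : EuclideanSpace ℝ (Fin 3)) :
    deriv (fun b => phi b x) a
      = (3 : ℝ) ^ ((1 : ℝ) / 4) / 4 * (a ^ (-(5 : ℝ) / 4) * phiProfile (‖x‖ ^ 2) a) := by
  have hu : 0 < 1 + a * ‖x‖ ^ 2 := by positivity
  have h3 : HasDerivAt (fun b : ℝ => 3 * b) 3 a := by
    simpa using (hasDerivAt_id a).const_mul (3 : ℝ)
  have h1 : HasDerivAt (fun b : ℝ => 1 + b * ‖x‖ ^ 2) (‖x‖ ^ 2) a := by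
    simpa using ((hasDerivAt_id a).mul_const (‖x‖ ^ 2)).const_add 1
  have hd := (h3.rpow_const (p := (1 : ℝ) / 4) (Or.inl (by positivity))).fun_mul
    (h1.rpow_const (p := -(1 : ℝ) / 2) (Or.inl hu.ne'))
  have e1 : (3 * a) ^ ((1 : ℝ) / 4 - 1) = (3 : ℝ) ^ ((1 : ℝ) / 4) * a ^ ((1 : ℝ) / 4) / (3 * a) := by
    rw [Real.rpow_sub_one (by positivity), Real.mul_rpow (by norm_num) ha.le]
  have e2 : (1 + a * ‖x‖ ^ 2) ^ (-(1 : ℝ) / 2)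
      = (1 + a * ‖x‖ ^ 2) ^ (-(3 : ℝ) / 2) * (1 + a * ‖x‖ ^ 2) := by
    rw [← Real.rpow_add_one hu.ne']; norm_num
  have e3 : a ^ (-(5 : ℝ) / 4) * a ^ ((1 : ℝ) / 2) = a ^ ((1 : ℝ) / 4) / a := by
    rw [← Real.rpow_add ha, ← Real.rpow_sub_one ha.ne']; norm_num
  have e4 : (-(1 : ℝ) / 2 - 1) = -(3 : ℝ) / 2 := by norm_num
  unfold phi phiProfile
  rw [hd.deriv, e1, e4, e2, Real.mul_rpow (by norm_num) ha.le, ← mul_assoc (a ^ (-(5 : ℝ) / 4)), e3]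
  field_simp
  ring

lemma hasDerivAt_phiProfile {s a : ℝ} (hs : 0 ≤ s) (ha : 0 < a) :
    HasDerivAt (phiProfile s)
      (1 / 2 * a ^ (-(1 : ℝ) / 2) * ((1 - 5 * (a * s)) * (1 + a * s) ^ (-(5 : ℝ) / 2))) a := by
  have hu : 0 < 1 + a * s := by positivity
  have h0 : HasDerivAt (fun b : ℝ => b * s) s a := by
    simpa using (hasDerivAt_id a).mul_const s
  have hd := ((hasDerivAt_id' a).rpow_const (p := (1 : ℝ) / 2) (Or.inl ha.ne')).fun_mul
    ((h0.const_sub 1).fun_mul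
      ((h0.const_add 1).rpow_const (p := -(3 : ℝ) / 2) (Or.inl hu.ne')))
  have e1 : a ^ ((1 : ℝ) / 2) = a ^ (-(1 : ℝ) / 2) * a := by
    rw [← Real.rpow_add_one ha.ne']; norm_num
  have e2 : (1 + a * s) ^ (-(3 : ℝ) / 2) = (1 + a * s) ^ (-(5 : ℝ) / 2) * (1 + a * s) := by
    rw [← Real.rpow_add_one hu.ne']; norm_num
  have e3 : ((1 : ℝ) / 2 - 1) = -(1 : ℝ) / 2 := by norm_num
  have e4 : (-(3 : ℝ) / 2 - 1) = -(5 : ℝ) / 2 := by norm_num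
  refine hd.congr_deriv ?_
  rw [e3, e4, e1, e2]
  ring

lemma rpow_neg_le_of_half_lt {a p : ℝ} (ha : 1 / 2 < a) (hp : 0 ≤ p) :
    a ^ (-p) ≤ 2 ^ p := by
  calc a ^ (-p) ≤ (1 / 2 : ℝ) ^ (-p) :=
        Real.rpow_le_rpow_of_nonpos (by norm_num) ha.le (by linarith)
    _ = 2 ^ p := by
        rw [one_div, Real.inv_rpow (by norm_num), Real.rpow_neg (by norm_num), inv_inv]

lemma one_add_mul_sq_rpow_le {a r : ℝ} (ha : 1 / 2 < a) (hr : 0 ≤ r) :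
    (1 + a * r ^ 2) ^ (-(3 : ℝ) / 2) ≤ 8 * (1 + r) ^ (-(3 : ℝ)) := by
  have h : ((1 + r) / 2) ^ 2 ≤ 1 + a * r ^ 2 := by
    nlinarith [sq_nonneg (r - 1), mul_le_mul_of_nonneg_right ha.le (sq_nonneg r)]
  calc (1 + a * r ^ 2) ^ (-(3 : ℝ) / 2) ≤ (((1 + r) / 2) ^ 2) ^ (-(3 : ℝ) / 2) :=
        Real.rpow_le_rpow_of_nonpos (by positivity) h (by norm_num)
    _ = ((1 + r) / 2) ^ (-(3 : ℝ)) := by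
        rw [← Real.rpow_natCast, ← Real.rpow_mul (by positivity)]; norm_num
    _ = 8 * (1 + r) ^ (-(3 : ℝ)) := by
        rw [Real.div_rpow (by positivity) (by norm_num), Real.rpow_neg zero_le_two]
        norm_num
        ring

lemma abs_deriv_phiProfile_le {a r : ℝ} (ha : 1 / 2 < a) (hr : 0 ≤ r) :
    |1 / 2 * a ^ (-(1 : ℝ) / 2) *
        ((1 - 5 * (a * r ^ 2)) * (1 + a * r ^ 2) ^ (-(5 : ℝ) / 2))|
      ≤ 40 * (1 + r) ^ (-(3 : ℝ)) := by
  have ha0 : 0 < a := by linarith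
  have hv : 0 ≤ a * r ^ 2 := by positivity
  have hu : 0 < 1 + a * r ^ 2 := by positivity
  have hroot : a ^ (-(1 : ℝ) / 2) ≤ 2 := by
    rw [neg_div]
    refine (rpow_neg_le_of_half_lt ha (by norm_num)).trans ?_
    exact (Real.rpow_le_rpow_of_exponent_le one_le_two (by norm_num)).trans_eq (Real.rpow_one 2)
  have hlin : |1 - 5 * (a * r ^ 2)| ≤ 5 * (1 + a * r ^ 2) := by
    rw [abs_le]; constructor <;> linarith
  have hpow : (1 + a * r ^ 2) ^ (-(3 : ℝ) / 2)
      = (1 + a * r ^ 2) * (1 + a * r ^ 2) ^ (-(5 : ℝ) / 2) := by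
    rw [mul_comm (1 + a * r ^ 2), ← Real.rpow_add_one hu.ne']; norm_num
  rw [abs_mul, abs_mul (1 - _), abs_of_nonneg (by positivity : 0 ≤ 1 / 2 * a ^ (-(1 : ℝ) / 2)),
    abs_of_pos (Real.rpow_pos_of_pos hu _)]
  calc _ ≤ 1 / 2 * 2 * (5 * (1 + a * r ^ 2) * (1 + a * r ^ 2) ^ (-(5 : ℝ) / 2)) := by gcongr
    _ = 5 * (1 + a * r ^ 2) ^ (-(3 : ℝ) / 2) := by rw [hpow]; ring
    _ ≤ 5 * (8 * (1 + r) ^ (-(3 : ℝ))) := by gcongr; exact one_add_mul_sq_rpow_le ha hr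
    _ = _ := by ring

lemma abs_phiProfile_sub_le {a₁ a₂ r : ℝ} (h₁ : 1 / 2 < a₁) (h₂ : 1 / 2 < a₂) (hr : 0 ≤ r) :
    |phiProfile (r ^ 2) a₁ - phiProfile (r ^ 2) a₂|
      ≤ 40 * (1 + r) ^ (-(3 : ℝ)) * |a₁ - a₂| :=
  (convex_Ioi (1 / 2 : ℝ)).norm_image_sub_le_of_norm_hasDerivWithin_le
    (fun _ hb => (hasDerivAt_phiProfile (sq_nonneg r)
      (one_half_pos.trans hb)).hasDerivWithinAt)
    (fun _ hb => abs_deriv_phiProfile_le hb hr) h₂ h₁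

/-- There is C > 0 such that for all a₁, a₂ ∈ (1/2, 2) and all x ∈ ℝ³:
|∂ₐφ(x,a₁) − (a₂/a₁)^{5/4} ∂ₐφ(x,a₂)| ≤ C|a₁ − a₂|(1+|x|)⁻³. -/
theorem deriv_phi_comparison :
    ∃ C > 0, ∀ a₁ ∈ Set.Ioo (1/2 : ℝ) 2, ∀ a₂ ∈ Set.Ioo (1/2 : ℝ) 2,
      ∀ x : EuclideanSpace ℝ (Fin 3),
        |deriv (fun b => phi b x) a₁
            - (a₂ / a₁) ^ ((5 : ℝ) / 4) * deriv (fun b => phi b x) a₂|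
          ≤ C * |a₁ - a₂| * (1 + ‖x‖) ^ (-(3 : ℝ)) := by
  refine ⟨160, by norm_num, ?_⟩
  rintro a₁ ⟨h₁, -⟩ a₂ ⟨h₂, -⟩ x
  have p₁ : 0 < a₁ := by linarith
  have p₂ : 0 < a₂ := by linarith
  have hK : (3 : ℝ) ^ ((1 : ℝ) / 4) / 4 ≤ 1 := by
    have := Real.rpow_le_rpow_of_exponent_le (by norm_num : (1 : ℝ) ≤ 3)
      (by norm_num : (1 : ℝ) / 4 ≤ 1)
    rw [Real.rpow_one] at this
    linarith
  have hA : a₁ ^ (-(5 : ℝ) / 4) ≤ 4 := by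
    rw [neg_div]
    refine (rpow_neg_le_of_half_lt h₁ (by norm_num)).trans ?_
    refine (Real.rpow_le_rpow_of_exponent_le one_le_two
      (by norm_num : (5 : ℝ) / 4 ≤ 2)).trans_eq ?_
    norm_num
  have hscale : (a₂ / a₁) ^ ((5 : ℝ) / 4) * a₂ ^ (-(5 : ℝ) / 4) = a₁ ^ (-(5 : ℝ) / 4) := by
    rw [Real.div_rpow p₂.le p₁.le, neg_div, Real.rpow_neg p₁.le, Real.rpow_neg p₂.le]
    have := (Real.rpow_pos_of_pos p₂ ((5 : ℝ) / 4)).ne'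
    field_simp
  have hfactor : deriv (fun b => phi b x) a₁
        - (a₂ / a₁) ^ ((5 : ℝ) / 4) * deriv (fun b => phi b x) a₂
      = (3 : ℝ) ^ ((1 : ℝ) / 4) / 4 * a₁ ^ (-(5 : ℝ) / 4) *
        (phiProfile (‖x‖ ^ 2) a₁ - phiProfile (‖x‖ ^ 2) a₂) := by
    rw [deriv_phi_eq p₁, deriv_phi_eq p₂]
    linear_combination
      -((3 : ℝ) ^ ((1 : ℝ) / 4) / 4 * phiProfile (‖x‖ ^ 2) a₂) * hscale
  rw [hfactor, abs_mul, abs_of_nonneg (by positivity)]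
  calc _ ≤ 1 * 4 * (40 * (1 + ‖x‖) ^ (-(3 : ℝ)) * |a₁ - a₂|) := by
        gcongr
        exact abs_phiProfile_sub_le h₁ h₂ (norm_nonneg x)
    _ = _ := by ring
end

section
/- Let 𝓗 be a complex Hilbert space, let S and A be bounded operators on 𝓗 with S ∘ S = S, let z ∈ ℂ with z ≠ 0, and assume A + S is invertible with inverse R = (A + S)^{-1}. Define B = z^{-1} (S − S R S). If there exists a bounded operator C on 𝓗 with C = S C S and C B = B C = S (i.e., B is invertible on the range of S with corner inverse C), then A is invertible and A^{-1} = R + z^{-1} R S C S R. -/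
open MeasureTheory

/-- Jensen–Nenciu inversion formula (sufficiency): on a complex Hilbert space, let
S be a bounded idempotent, z ≠ 0, A bounded with A + S invertible with inverse R,
and B = z⁻¹(S − SRS). If C is a bounded operator with C = SCS and CB = BC = S
(the inverse of B on the range of S), then A is invertible and
A⁻¹ = R + z⁻¹ R S C S R. -/
theorem jensen_nenciu_inversion {H : Type*} [NormedAddCommGroup H]
    [InnerProductSpace ℂ H] [CompleteSpace H]
    (S A R C : H →L[ℂ] H) (z : ℂ) (hz : z ≠ 0)
    (hS : S * S = S)
    (hR₁ : R * (A + S) = 1) (hR₂ : (A + S) * R = 1)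
    (hC : C = S * C * S)
    (hCB : C * (z⁻¹ • (S - S * R * S)) = S)
    (hBC : (z⁻¹ • (S - S * R * S)) * C = S) :
    (R + z⁻¹ • (R * S * C * S * R)) * A = 1 ∧
      A * (R + z⁻¹ • (R * S * C * S * R)) = 1 := by
  have hCS : C * S = C := by
    rw [hC, mul_assoc, hS]
  have hSC : S * C = C := by
    rw [hC, ← mul_assoc, ← mul_assoc, hS]
  have hRSCSR : R * S * C * S * R = R * C * R := by
    rw [mul_assoc R S C, hSC, mul_assoc R C S, hCS]
  have hRA : R * A = 1 - R * S := by
    rw [← hR₁, mul_add, add_sub_cancel_right]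
  have hAR : A * R = 1 - S * R := by
    rw [← hR₂, add_mul, add_sub_cancel_right]
  have hleft : z⁻¹ • (C - C * R * S) = S := by
    rwa [mul_smul_comm, mul_sub, ← mul_assoc, ← mul_assoc, hCS] at hCB
  have hright : z⁻¹ • (C - S * R * C) = S := by
    rwa [smul_mul_assoc, sub_mul, mul_assoc (S * R) S C, hSC] at hBC
  rw [hRSCSR]
  constructor
  · calc (R + z⁻¹ • (R * C * R)) * A = R * A + z⁻¹ • (R * C * (R * A)) := by
          rw [add_mul, smul_mul_assoc, mul_assoc (R * C)]
      _ = 1 - R * S + R * (z⁻¹ • (C - C * R * S)) := by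
          rw [hRA, mul_smul_comm]
          simp only [mul_sub, mul_one, mul_assoc]
      _ = 1 := by rw [hleft, sub_add_cancel]
  · calc A * (R + z⁻¹ • (R * C * R)) = A * R + z⁻¹ • (A * R * (C * R)) := by
          rw [mul_add, mul_smul_comm, mul_assoc R, ← mul_assoc A]
      _ = 1 - S * R + (z⁻¹ • (C - S * R * C)) * R := by
          rw [hAR, smul_mul_assoc]
          simp only [sub_mul, one_mul, mul_assoc]
      _ = 1 := by rw [hright, sub_add_cancel]
end

section
/- Let 𝓗 be a complex Hilbert space, let S and A be bounded operators on 𝓗 with S ∘ S = S, let z ∈ ℂ with z ≠ 0, and assume A + S is invertible with inverse R = (A + S)^{-1}. Define B = z^{-1} (S − S R S). If A is invertible, then the bounded operator C := z (S + S A^{-1} S) satisfies C = S C S and C B = B C = S; in particular B is invertible on the range of S. -/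
open MeasureTheory

theorem compression_add_mul_compression_sub {M : Type*} [Ring M] {S X Y : M}
    (hS : S * S = S) (h : X * S * Y = X - Y) :
    (S + S * X * S) * (S - S * Y * S) = S := by
  have hXY : S * X * S * (S * Y * S) = S * X * S - S * Y * S := by
    calc S * X * S * (S * Y * S) = S * (X * (S * S) * Y) * S := by simp only [mul_assoc]
      _ = S * X * S - S * Y * S := by rw [hS, h, mul_sub, sub_mul]
  have hY : S * (S * Y * S) = S * Y * S := by rw [← mul_assoc, ← mul_assoc, hS]
  have hX : S * X * S * S = S * X * S := by rw [mul_assoc, hS]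
  rw [add_mul, mul_sub, mul_sub, hXY, hX, hY, hS]
  abel

theorem compression_sub_mul_compression_add {M : Type*} [Ring M] {S X Y : M}
    (hS : S * S = S) (h : Y * S * X = X - Y) :
    (S - S * Y * S) * (S + S * X * S) = S := by
  have h_neg : -Y * S * -X = -Y - -X := by
    rw [neg_mul, neg_mul_neg, h]
    abel
  simpa [← sub_eq_add_neg] using compression_add_mul_compression_sub hS h_neg

/-- Jensen–Nenciu lemma (necessity): on a complex Hilbert space, let S be a bounded
idempotent, z ≠ 0, A bounded with A + S invertible with inverse R, and
B = z⁻¹(S − SRS). If A is invertible (with two-sided inverse A'), then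
C := z(S + S A⁻¹ S) satisfies C = SCS and CB = BC = S; in particular B is invertible
on the range of S. -/
theorem jensen_nenciu_necessity {H : Type*} [NormedAddCommGroup H]
    [InnerProductSpace ℂ H] [CompleteSpace H]
    (S A R A' : H →L[ℂ] H) (z : ℂ) (hz : z ≠ 0)
    (hS : S * S = S)
    (hR₁ : R * (A + S) = 1) (hR₂ : (A + S) * R = 1)
    (hA₁ : A' * A = 1) (hA₂ : A * A' = 1) :
    z • (S + S * A' * S) = S * (z • (S + S * A' * S)) * S ∧
    (z • (S + S * A' * S)) * (z⁻¹ • (S - S * R * S)) = S ∧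
    (z⁻¹ • (S - S * R * S)) * (z • (S + S * A' * S)) = S := by
  have hSA : A' * S * R = A' - R := by
    calc A' * S * R = A' * ((A + S) * R) - A' * A * R := by noncomm_ring
      _ = A' - R := by rw [hR₂, hA₁, mul_one, one_mul]
  have hRS : R * S * A' = A' - R := by
    calc R * S * A' = R * (A + S) * A' - R * (A * A') := by noncomm_ring
      _ = A' - R := by rw [hR₁, hA₂, mul_one, one_mul]
  refine ⟨?_, ?_, ?_⟩
  · have hSAS : S * (S * A' * S) * S = S * A' * S := by
      rw [← mul_assoc, ← mul_assoc, hS, mul_assoc (S * A'), hS]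
    rw [mul_smul_comm, smul_mul_assoc, mul_add, add_mul, hSAS, hS, hS]
  · rw [smul_mul_smul_comm, mul_inv_cancel₀ hz, one_smul,
      compression_add_mul_compression_sub hS hSA]
  · rw [smul_mul_smul_comm, inv_mul_cancel₀ hz, one_smul,
      compression_sub_mul_compression_add hS hRS]
end

section
/- Let d ≥ 1 be an integer, σ > 0, and let Ψ be a solution of the focusing nonlinear Schrödinger equation i∂_tΨ + ΔΨ + |Ψ|^{2σ}Ψ = 0 on ℝ × ℝ^d such that the map t ↦ Ψ(t,·) is a smooth curve in the Schwartz space 𝒮(ℝ^d; ℂ). Then the virial function y(t) = ∫_{ℝ^d} |x|² |Ψ(t,x)|² dx is twice differentiable in t and y''(t) = 8 ∫_{ℝ^d} |∇Ψ(t,x)|² dx − (4dσ/(σ+1)) ∫_{ℝ^d} |Ψ(t,x)|^{2σ+2} dx for all t. -/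
open MeasureTheory Filter

/-- The Laplacian of a complex-valued function: sum of second partial derivatives
in the coordinate directions. -/
noncomputable def lapC {d : ℕ} (f : EuclideanSpace ℝ (Fin d) → ℂ)
    (x : EuclideanSpace ℝ (Fin d)) : ℂ :=
  ∑ j, fderiv ℝ (fun y => fderiv ℝ f y (EuclideanSpace.single j 1)) x
    (EuclideanSpace.single j 1)

/-- A smooth curve in Schwartz space: there is a sequence of curves of Schwartz
functions, starting with the given one, each the derivative of the previous one in
the (Fréchet) topology of Schwartz space. -/
def SmoothSchwartzCurve {d : ℕ}
    (Ψ : ℝ → SchwartzMap (EuclideanSpace ℝ (Fin d)) ℂ) : Prop :=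
  ∃ D : ℕ → ℝ → SchwartzMap (EuclideanSpace ℝ (Fin d)) ℂ, D 0 = Ψ ∧
    ∀ n t, Tendsto (fun h : ℝ => (h⁻¹ : ℝ) • (D n (t + h) - D n t))
      (nhdsWithin 0 {(0 : ℝ)}ᶜ) (nhds (D (n + 1) t))

namespace Virial

open scoped LineDeriv SchwartzMap

variable {d : ℕ}

/-- The `j`-th standard basis vector. -/
noncomputable abbrev e (j : Fin d) : EuclideanSpace ℝ (Fin d) := EuclideanSpace.single j 1

/-- Multiplication by the `j`-th coordinate on Schwartz space. -/
noncomputable def coordMul (j : Fin d) :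
    𝓢(EuclideanSpace ℝ (Fin d), ℂ) →L[ℝ] 𝓢(EuclideanSpace ℝ (Fin d), ℂ) :=
  SchwartzMap.smulLeftCLM ℂ (fun x : EuclideanSpace ℝ (Fin d) => x j)

lemma coordMul_apply (j : Fin d) (f : 𝓢(EuclideanSpace ℝ (Fin d), ℂ))
    (x : EuclideanSpace ℝ (Fin d)) : coordMul j f x = (x j : ℝ) • f x :=
  SchwartzMap.smulLeftCLM_apply_apply
    (EuclideanSpace.proj (𝕜 := ℝ) j).hasTemperateGrowth f x

/-- Multiplication by the imaginary unit on Schwartz space. -/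
noncomputable def mulI :
    𝓢(EuclideanSpace ℝ (Fin d), ℂ) →L[ℝ] 𝓢(EuclideanSpace ℝ (Fin d), ℂ) :=
  (Complex.I • ContinuousLinearMap.id ℂ
    𝓢(EuclideanSpace ℝ (Fin d), ℂ)).restrictScalars ℝ

lemma mulI_apply (f : 𝓢(EuclideanSpace ℝ (Fin d), ℂ))
    (x : EuclideanSpace ℝ (Fin d)) : mulI f x = Complex.I * f x := rfl

/-- The real `L²` pairing of Schwartz functions. -/
noncomputable def pair (f g : 𝓢(EuclideanSpace ℝ (Fin d), ℂ)) : ℝ :=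
  inner ℝ (SchwartzMap.toLpCLM ℝ ℂ 2 volume f) (SchwartzMap.toLpCLM ℝ ℂ 2 volume g)

lemma integrable_inner (f g : 𝓢(EuclideanSpace ℝ (Fin d), ℂ)) :
    Integrable (fun x => inner ℝ (f x) (g x)) :=
  (SchwartzMap.pairing (innerSL ℝ) f g).integrable

lemma pair_eq_integral (f g : 𝓢(EuclideanSpace ℝ (Fin d), ℂ)) :
    pair f g = ∫ x, inner ℝ (f x) (g x) := by
  rw [pair, L2.inner_def]
  refine integral_congr_ae ?_
  filter_upwards [f.coeFn_toLp 2 volume, g.coeFn_toLp 2 volume] with x hf hg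
  simp only [SchwartzMap.toLpCLM_apply, hf, hg]

lemma pair_comm (f g : 𝓢(EuclideanSpace ℝ (Fin d), ℂ)) : pair f g = pair g f :=
  real_inner_comm _ _

lemma pair_add_left (f g h : 𝓢(EuclideanSpace ℝ (Fin d), ℂ)) :
    pair (f + g) h = pair f h + pair g h := by
  simp only [pair, map_add, inner_add_left]

lemma pair_add_right (f g h : 𝓢(EuclideanSpace ℝ (Fin d), ℂ)) :
    pair f (g + h) = pair f g + pair f h := by
  simp only [pair, map_add, inner_add_right]

lemma pair_neg_left (f g : 𝓢(EuclideanSpace ℝ (Fin d), ℂ)) :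
    pair (-f) g = -pair f g := by
  simp only [pair, map_neg, inner_neg_left]

lemma pair_neg_right (f g : 𝓢(EuclideanSpace ℝ (Fin d), ℂ)) :
    pair f (-g) = -pair f g := by
  simp only [pair, map_neg, inner_neg_right]

lemma pair_sum_left {ι : Type*} (s : Finset ι) (f : ι → 𝓢(EuclideanSpace ℝ (Fin d), ℂ))
    (g : 𝓢(EuclideanSpace ℝ (Fin d), ℂ)) :
    pair (∑ i ∈ s, f i) g = ∑ i ∈ s, pair (f i) g := by
  simp only [pair, map_sum, sum_inner]

lemma pair_sum_right {ι : Type*} (s : Finset ι) (f : 𝓢(EuclideanSpace ℝ (Fin d), ℂ))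
    (g : ι → 𝓢(EuclideanSpace ℝ (Fin d), ℂ)) :
    pair f (∑ i ∈ s, g i) = ∑ i ∈ s, pair f (g i) := by
  simp only [pair, map_sum, inner_sum]

lemma pair_coordMul (j : Fin d) (f g : 𝓢(EuclideanSpace ℝ (Fin d), ℂ)) :
    pair (coordMul j f) g = pair f (coordMul j g) := by
  simp only [pair_eq_integral, coordMul_apply, real_inner_smul_left, real_inner_smul_right]

lemma pair_mulI (f g : 𝓢(EuclideanSpace ℝ (Fin d), ℂ)) :
    pair (mulI f) g = -pair f (mulI g) := by
  simp only [pair_eq_integral, ← integral_neg, mulI_apply]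
  congr with x
  simp [Complex.inner]
  ring

lemma pair_lineDeriv (v : EuclideanSpace ℝ (Fin d)) (f g : 𝓢(EuclideanSpace ℝ (Fin d), ℂ)) :
    pair (∂_{v} f) g = -pair f (∂_{v} g) := by
  simp only [pair_eq_integral]
  exact (neg_eq_iff_eq_neg.mpr
    (SchwartzMap.integral_bilinear_lineDerivOp_right_eq_neg_left f g (innerSL ℝ) v)).symm

lemma mulI_mulI (f : 𝓢(EuclideanSpace ℝ (Fin d), ℂ)) : mulI (mulI f) = -f := by
  ext x
  simp [mulI_apply, ← mul_assoc]

lemma mulI_coordMul (j : Fin d) (f : 𝓢(EuclideanSpace ℝ (Fin d), ℂ)) :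
    mulI (coordMul j f) = coordMul j (mulI f) := by
  ext x
  simp only [mulI_apply, coordMul_apply, mul_smul_comm]

lemma coordMul_comm (j k : Fin d) (f : 𝓢(EuclideanSpace ℝ (Fin d), ℂ)) :
    coordMul j (coordMul k f) = coordMul k (coordMul j f) := by
  ext x
  rw [coordMul_apply, coordMul_apply, coordMul_apply, coordMul_apply, smul_comm]

lemma lineDeriv_mulI (v : EuclideanSpace ℝ (Fin d)) (f : 𝓢(EuclideanSpace ℝ (Fin d), ℂ)) :
    ∂_{v} (mulI f) = mulI (∂_{v} f) :=
  LineDeriv.lineDerivOp_smul v Complex.I f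

lemma lineDeriv_comm (v w : EuclideanSpace ℝ (Fin d)) (f : 𝓢(EuclideanSpace ℝ (Fin d), ℂ)) :
    ∂_{v} (∂_{w} f) = ∂_{w} (∂_{v} f) := by
  ext x
  have key : ∀ a b : EuclideanSpace ℝ (Fin d), ∂_{a} (∂_{b} f) x
      = fderiv ℝ (fderiv ℝ f) x a b := by
    intro a b
    rw [SchwartzMap.lineDerivOp_apply_eq_fderiv]
    have h := ((SchwartzMap.fderivCLM ℝ (EuclideanSpace ℝ (Fin d)) ℂ f).hasFDerivAt x).clm_apply
      (hasFDerivAt_const b x)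
    have h' : HasFDerivAt (∂_{b} f : 𝓢(EuclideanSpace ℝ (Fin d), ℂ)) _ x := h
    rw [h'.fderiv]
    simp
    rfl
  rw [key, key]
  refine second_derivative_symmetric (x := x) (f := f) (f' := fderiv ℝ f) (fun y => f.hasFDerivAt y) ?_ v w
  exact (SchwartzMap.fderivCLM ℝ (EuclideanSpace ℝ (Fin d)) ℂ f).hasFDerivAt x

lemma lineDeriv_coordMul (j k : Fin d) (f : 𝓢(EuclideanSpace ℝ (Fin d), ℂ)) :
    ∂_{e k} (coordMul j f) = (if j = k then f else 0) + coordMul j (∂_{e k} f) := by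
  ext x
  have h1 : HasFDerivAt (fun y : EuclideanSpace ℝ (Fin d) => y j)
      (EuclideanSpace.proj (𝕜 := ℝ) j) x :=
    (EuclideanSpace.proj (𝕜 := ℝ) j).hasFDerivAt
  have h2 := h1.smul (f.hasFDerivAt x)
  have h3 : (coordMul j f : EuclideanSpace ℝ (Fin d) → ℂ) = fun y => (y j : ℝ) • f y :=
    funext (coordMul_apply j f)
  rw [SchwartzMap.lineDerivOp_apply_eq_fderiv, h3]
  erw [h2.fderiv]
  by_cases h : j = k <;>
    simp [h, coordMul_apply, SchwartzMap.lineDerivOp_apply_eq_fderiv, add_comm]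

/-- Composition of a differentiable curve of Schwartz functions with a continuous linear map
into a normed space is differentiable. -/
lemma hasDerivAt_clm_comp {u : ℝ → 𝓢(EuclideanSpace ℝ (Fin d), ℂ)}
    {v : 𝓢(EuclideanSpace ℝ (Fin d), ℂ)} {t : ℝ}
    (h : Tendsto (fun h : ℝ => (h⁻¹ : ℝ) • (u (t + h) - u t))
      (nhdsWithin 0 {(0 : ℝ)}ᶜ) (nhds v))
    {F : Type*} [NormedAddCommGroup F] [NormedSpace ℝ F]
    (A : 𝓢(EuclideanSpace ℝ (Fin d), ℂ) →L[ℝ] F) :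
    HasDerivAt (fun s => A (u s)) (A v) t := by
  rw [hasDerivAt_iff_tendsto_slope_zero]
  have := (A.continuous.tendsto v).comp h
  simpa [Function.comp_def] using this

lemma hasDerivAt_pair {u : ℝ → 𝓢(EuclideanSpace ℝ (Fin d), ℂ)}
    {v : 𝓢(EuclideanSpace ℝ (Fin d), ℂ)} {t : ℝ}
    (h : Tendsto (fun h : ℝ => (h⁻¹ : ℝ) • (u (t + h) - u t))
      (nhdsWithin 0 {(0 : ℝ)}ᶜ) (nhds v))
    (A B : 𝓢(EuclideanSpace ℝ (Fin d), ℂ) →L[ℝ] 𝓢(EuclideanSpace ℝ (Fin d), ℂ)) :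
    HasDerivAt (fun s => pair (A (u s)) (B (u s)))
      (pair (A (u t)) (B v) + pair (A v) (B (u t))) t :=
  (hasDerivAt_clm_comp h (SchwartzMap.toLpCLM ℝ ℂ 2 volume ∘L A)).inner ℝ
    (hasDerivAt_clm_comp h (SchwartzMap.toLpCLM ℝ ℂ 2 volume ∘L B))

lemma pair_mulI_self (f : 𝓢(EuclideanSpace ℝ (Fin d), ℂ)) : pair (mulI f) f = 0 := by
  have h := pair_mulI f f
  rw [pair_comm f] at h
  linarith

lemma pair_coordMul_lineDeriv_self (j : Fin d) (f : 𝓢(EuclideanSpace ℝ (Fin d), ℂ)) :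
    pair f (coordMul j (∂_{e j} f)) = -(1 / 2) * pair f f := by
  have h := pair_lineDeriv (e j) (coordMul j f) f
  rw [lineDeriv_coordMul, if_pos rfl, pair_add_left, pair_coordMul j f,
    pair_comm (coordMul j _)] at h
  linarith

/-- The Laplacian of a Schwartz function, as a Schwartz function. -/
noncomputable def lap (f : 𝓢(EuclideanSpace ℝ (Fin d), ℂ)) : 𝓢(EuclideanSpace ℝ (Fin d), ℂ) :=
  ∑ k : Fin d, ∂_{e k} (∂_{e k} f)

lemma lap_apply (f : 𝓢(EuclideanSpace ℝ (Fin d), ℂ)) (x : EuclideanSpace ℝ (Fin d)) :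
    lap f x = lapC f x := by
  rw [lap, sum_apply]
  rfl

lemma pair_lap_self (f : 𝓢(EuclideanSpace ℝ (Fin d), ℂ)) :
    pair f (lap f) = -∑ k : Fin d, pair (∂_{e k} f) (∂_{e k} f) := by
  rw [lap, pair_sum_right, ← Finset.sum_neg_distrib]
  refine Finset.sum_congr rfl fun k _ => ?_
  rw [pair_lineDeriv, neg_neg]

lemma pair_coordMul_mulI_lap (j : Fin d) (f : 𝓢(EuclideanSpace ℝ (Fin d), ℂ)) :
    pair (coordMul j f) (coordMul j (mulI (lap f)))
      = 2 * pair (mulI (coordMul j f)) (∂_{e j} f) := by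
  have h : ∀ k : Fin d, pair (coordMul j f) (coordMul j (mulI (∂_{e k} (∂_{e k} f))))
      = if j = k then 2 * pair (mulI (coordMul j f)) (∂_{e k} f) else 0 := by
    intro k
    have h0 := pair_mulI_self (coordMul j (∂_{e k} f))
    rw [← pair_coordMul, ← neg_inj, ← pair_mulI, pair_comm, pair_lineDeriv, pair_comm,
      lineDeriv_mulI, lineDeriv_coordMul, lineDeriv_coordMul]
    rw [← pair_coordMul, ← mulI_coordMul] at h0
    split_ifs
    · simp only [map_add, pair_add_left, h0]
      ring
    · simp [h0]
  rw [lap, map_sum, map_sum, pair_sum_right, Finset.sum_congr rfl fun k _ => h k]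
  simp

lemma sum_pair_coordMul_lap (f : 𝓢(EuclideanSpace ℝ (Fin d), ℂ)) :
    ∑ j, pair (coordMul j (lap f)) (∂_{e j} f)
      = (d / 2 - 1) * ∑ k : Fin d, pair (∂_{e k} f) (∂_{e k} f) := by
  have h : ∀ j k : Fin d, pair (coordMul j (∂_{e k} (∂_{e k} f))) (∂_{e j} f)
      = 1 / 2 * pair (∂_{e k} f) (∂_{e k} f)
        - if j = k then pair (∂_{e k} f) (∂_{e k} f) else 0 := by
    intro j k
    rw [pair_coordMul, pair_lineDeriv, lineDeriv_coordMul, lineDeriv_comm (e k) (e j),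
      pair_add_right, pair_coordMul_lineDeriv_self]
    split_ifs with hjk
    · subst hjk
      ring
    · simp [pair, -SchwartzMap.toLpCLM_apply]
  simp only [lap, map_sum, pair_sum_left, h, Finset.sum_sub_distrib, Finset.sum_const,
    Finset.sum_ite_eq, Finset.mem_univ, if_true, Finset.card_univ, Fintype.card_fin, nsmul_eq_mul,
    ← Finset.mul_sum]
  ring

lemma pair_mulI_coordMul_lineDeriv_add (f g : 𝓢(EuclideanSpace ℝ (Fin d), ℂ)) (j : Fin d) :
    pair (mulI (coordMul j f)) (∂_{e j} (mulI g)) + pair (mulI (coordMul j (mulI g))) (∂_{e j} f)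
      = -2 * pair (coordMul j g) (∂_{e j} f) - pair f g := by
  have h : pair (mulI (coordMul j (mulI g))) (∂_{e j} f)
      = -pair (coordMul j g) (∂_{e j} f) := by
    rw [← mulI_coordMul, mulI_mulI, pair_neg_left]
  rw [h, lineDeriv_mulI, pair_mulI, mulI_mulI, pair_neg_right, neg_neg, pair_comm, pair_lineDeriv,
    lineDeriv_coordMul, if_pos rfl, pair_add_right, ← pair_coordMul, pair_comm g f]
  ring

section PowerNonlinearity

variable {σ : ℝ} {u N : 𝓢(EuclideanSpace ℝ (Fin d), ℂ)}

lemma pair_coordMul_mulI_power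
    (hN : ∀ x, N x = ((‖u x‖ ^ (2 * σ) : ℝ) : ℂ) * u x) (j : Fin d) :
    pair (coordMul j u) (coordMul j (mulI N)) = 0 := by
  rw [pair_eq_integral]
  refine (integral_congr_ae (.of_forall fun x => ?_)).trans (integral_zero _ _)
  simp only [coordMul_apply, mulI_apply, hN, real_inner_smul_left, real_inner_smul_right]
  simp [Complex.inner]
  ring_nf
  simp

lemma inner_power (hσ : 0 < σ) (hN : ∀ x, N x = ((‖u x‖ ^ (2 * σ) : ℝ) : ℂ) * u x)
    (x : EuclideanSpace ℝ (Fin d)) : inner ℝ (u x) (N x) = ‖u x‖ ^ (2 * σ + 2) := by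
  rw [hN, ← Complex.real_smul, real_inner_smul_right, real_inner_self_eq_norm_sq,
    Real.rpow_add' (norm_nonneg _) (by positivity), Real.rpow_two]

lemma pair_power (hσ : 0 < σ) (hN : ∀ x, N x = ((‖u x‖ ^ (2 * σ) : ℝ) : ℂ) * u x) :
    pair u N = ∫ x, ‖u x‖ ^ (2 * σ + 2) := by
  rw [pair_eq_integral]
  exact integral_congr_ae (.of_forall (inner_power hσ hN))

lemma hasFDerivAt_norm_power (hσ : 0 < σ)
    (x : EuclideanSpace ℝ (Fin d)) : HasFDerivAt (fun y => ‖u y‖ ^ (2 * σ + 2))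
      (((2 * σ + 2) * ‖u x‖ ^ (2 * σ)) • (innerSL ℝ (u x)) ∘L (fderiv ℝ u x)) x := by
  have h := (hasFDerivAt_norm_rpow (u x) (p := 2 * σ + 2) (by linarith)).comp x (u.hasFDerivAt x)
  rwa [add_sub_cancel_right] at h

lemma pair_coordMul_power_lineDeriv (hσ : 0 < σ)
    (hN : ∀ x, N x = ((‖u x‖ ^ (2 * σ) : ℝ) : ℂ) * u x) (j : Fin d) :
    pair (coordMul j N) (∂_{e j} u) = -(1 / (2 * σ + 2)) * ∫ x, ‖u x‖ ^ (2 * σ + 2) := by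
  have hproj : ∀ x : EuclideanSpace ℝ (Fin d),
      HasFDerivAt (fun y : EuclideanSpace ℝ (Fin d) => y j)
        (EuclideanSpace.proj (𝕜 := ℝ) j) x :=
    fun x => (EuclideanSpace.proj (𝕜 := ℝ) j).hasFDerivAt
  have h1 : ∀ x : EuclideanSpace ℝ (Fin d),
      fderiv ℝ (fun y : EuclideanSpace ℝ (Fin d) => y j) x (e j) = 1 := by
    intro x
    erw [(hproj x).fderiv]
    simp
  have h2 : ∀ x, x j * fderiv ℝ (fun y => ‖u y‖ ^ (2 * σ + 2)) x (e j)
      = (2 * σ + 2) * inner ℝ (coordMul j N x) ((∂_{e j} u) x) := by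
    intro x
    rw [(hasFDerivAt_norm_power hσ x).fderiv, coordMul_apply, hN, ← Complex.real_smul,
      real_inner_smul_left, real_inner_smul_left, SchwartzMap.lineDerivOp_apply_eq_fderiv]
    simp
    ring
  have hibp := integral_mul_fderiv_eq_neg_fderiv_mul_of_integrable (μ := volume)
    (f := fun y : EuclideanSpace ℝ (Fin d) => y j) (g := fun y => ‖u y‖ ^ (2 * σ + 2)) (v := e j)
    (by simpa only [h1, one_mul, inner_power hσ hN] using integrable_inner u N)
    (by simpa only [h2] using (integrable_inner (coordMul j N) (∂_{e j} u)).const_mul _)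
    (by simpa only [coordMul_apply, real_inner_smul_left, inner_power hσ hN]
        using integrable_inner (coordMul j u) N)
    (fun x _ => (hproj x).differentiableAt)
    (fun x _ => (hasFDerivAt_norm_power hσ x).differentiableAt)
  simp only [h1, h2, one_mul, integral_const_mul, ← pair_eq_integral] at hibp
  have : 2 * σ + 2 ≠ 0 := by positivity
  rw [neg_mul, one_div_mul_eq_div, ← neg_div, eq_div_iff this, mul_comm, hibp]

end PowerNonlinearity

lemma sum_pair_coordMul_self (f : 𝓢(EuclideanSpace ℝ (Fin d), ℂ)) :
    ∑ j, pair (coordMul j f) (coordMul j f) = ∫ x, ‖x‖ ^ 2 * ‖f x‖ ^ 2 := by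
  simp only [pair_eq_integral]
  rw [← integral_finsetSum _ fun j _ => integrable_inner _ _]
  refine integral_congr_ae (.of_forall fun x => ?_)
  simp only [coordMul_apply, real_inner_self_eq_norm_sq, norm_smul, mul_pow,
    EuclideanSpace.norm_sq_eq, Finset.sum_mul]

lemma sum_pair_lineDeriv_self (f : 𝓢(EuclideanSpace ℝ (Fin d), ℂ)) :
    ∑ j : Fin d, pair (∂_{e j} f) (∂_{e j} f) = ∫ x, ∑ j, ‖fderiv ℝ f x (e j)‖ ^ 2 := by
  simp only [pair_eq_integral]
  rw [← integral_finsetSum _ fun j _ => integrable_inner _ _]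
  simp only [real_inner_self_eq_norm_sq, SchwartzMap.lineDerivOp_apply_eq_fderiv]

end Virial

/-- Virial identity: if Ψ is a solution of the focusing NLS
i∂ₜΨ + ΔΨ + |Ψ|^{2σ}Ψ = 0 which is a smooth curve in Schwartz space, then
y(t) = ∫ |x|²|Ψ(t,x)|² dx is twice differentiable and
y''(t) = 8∫|∇Ψ|² − (4dσ/(σ+1))∫|Ψ|^{2σ+2}. -/
theorem virial_identity (d : ℕ) (hd : 1 ≤ d) (σ : ℝ) (hσ : 0 < σ)
    (Ψ : ℝ → SchwartzMap (EuclideanSpace ℝ (Fin d)) ℂ)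
    (hsmooth : SmoothSchwartzCurve Ψ)
    (hNLS : ∀ (t : ℝ) (x : EuclideanSpace ℝ (Fin d)),
      Complex.I * deriv (fun s => Ψ s x) t + lapC (fun y => Ψ t y) x
        + ((‖Ψ t x‖ ^ (2 * σ) : ℝ) : ℂ) * Ψ t x = 0) :
    (∀ t, DifferentiableAt ℝ
        (fun s => ∫ x, ‖x‖ ^ 2 * ‖Ψ s x‖ ^ 2) t) ∧
    (∀ t, DifferentiableAt ℝ
        (deriv (fun s => ∫ x, ‖x‖ ^ 2 * ‖Ψ s x‖ ^ 2)) t) ∧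
    (∀ t, deriv (deriv (fun s => ∫ x, ‖x‖ ^ 2 * ‖Ψ s x‖ ^ 2)) t
        = 8 * (∫ x, ∑ j, ‖fderiv ℝ (fun y => Ψ t y) x (EuclideanSpace.single j 1)‖ ^ 2)
          - (4 * d * σ / (σ + 1)) * ∫ x, ‖Ψ t x‖ ^ (2 * σ + 2)) := by
  open scoped LineDeriv in
  obtain ⟨D, rfl, hD⟩ := hsmooth
  set N : ℝ → SchwartzMap (EuclideanSpace ℝ (Fin d)) ℂ :=
    fun t => -Virial.mulI (D 1 t) - Virial.lap (D 0 t) with hNdef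
  have hN : ∀ t x, N t x = ((‖D 0 t x‖ ^ (2 * σ) : ℝ) : ℂ) * D 0 t x := by
    intro t x
    have hd : deriv (fun s => D 0 s x) t = D 1 t x :=
      (Virial.hasDerivAt_clm_comp (hD 0 t) (BoundedContinuousFunction.evalCLM ℝ x ∘L
        SchwartzMap.toBoundedContinuousFunctionCLM ℝ (EuclideanSpace ℝ (Fin d)) ℂ)).deriv
    have h := hNLS t x
    rw [hd, ← Virial.lap_apply] at h
    simp only [hNdef, sub_apply, neg_apply, Virial.mulI_apply]
    linear_combination -h
  have hv : ∀ t, D 1 t = Virial.mulI (Virial.lap (D 0 t) + N t) := by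
    intro t
    simp only [hNdef, add_sub_cancel, map_neg, Virial.mulI_mulI, neg_neg]
  have hy : ∀ t, HasDerivAt (fun s => ∫ x, ‖x‖ ^ 2 * ‖D 0 s x‖ ^ 2)
      (4 * ∑ j, Virial.pair (Virial.mulI (Virial.coordMul j (D 0 t)))
        (∂_{Virial.e j} (D 0 t))) t := by
    intro t
    simp only [← Virial.sum_pair_coordMul_self]
    refine (HasDerivAt.fun_sum fun j (_ : j ∈ Finset.univ) => Virial.hasDerivAt_pair (hD 0 t)
      (Virial.coordMul j) (Virial.coordMul j)).congr_deriv ?_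
    symm
    rw [Finset.mul_sum]
    refine Finset.sum_congr rfl fun j _ => ?_
    rw [Virial.pair_comm (Virial.coordMul j (D (0 + 1) t)), zero_add, hv t, map_add, map_add,
      Virial.pair_add_right, Virial.pair_coordMul_mulI_lap,
      Virial.pair_coordMul_mulI_power (hN t)]
    ring
  have hy' : ∀ t, HasDerivAt (deriv (fun s => ∫ x, ‖x‖ ^ 2 * ‖D 0 s x‖ ^ 2))
      (8 * (∫ x, ∑ j, ‖fderiv ℝ (fun y => D 0 t y) x (EuclideanSpace.single j 1)‖ ^ 2)
          - (4 * d * σ / (σ + 1)) * ∫ x, ‖D 0 t x‖ ^ (2 * σ + 2)) t := by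
    intro t
    rw [funext fun s => (hy s).deriv]
    refine ((HasDerivAt.fun_sum fun j (_ : j ∈ Finset.univ) => Virial.hasDerivAt_pair (hD 0 t)
      (Virial.mulI ∘L Virial.coordMul j)
      (LineDeriv.lineDerivOpCLM ℝ _ (Virial.e j))).const_mul 4).congr_deriv ?_
    simp only [zero_add, hv t, ContinuousLinearMap.comp_apply, LineDeriv.lineDerivOpCLM_apply,
      Virial.pair_mulI_coordMul_lineDeriv_add, Finset.sum_sub_distrib, ← Finset.mul_sum, Finset.sum_const,
      Finset.card_univ, Fintype.card_fin, nsmul_eq_mul]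
    simp only [map_add, Virial.pair_add_left, Virial.pair_add_right, Finset.sum_add_distrib,
      Virial.sum_pair_coordMul_lap, Virial.pair_coordMul_power_lineDeriv hσ (hN t),
      Virial.pair_lap_self, Virial.pair_power hσ (hN t), Finset.sum_const, Finset.card_univ,
      Fintype.card_fin, nsmul_eq_mul, ← Virial.sum_pair_lineDeriv_self]
    have h1 : σ + 1 ≠ 0 := by positivity
    have h2 : 2 * σ + 2 = 2 * (σ + 1) := by ring
    rw [h2]
    field_simp
    ring
  exact ⟨fun t => (hy t).differentiableAt, fun t => (hy' t).differentiableAt,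
    fun t => (hy' t).deriv⟩
end
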